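/- arXiv:2602.11331 — 2 statements merged into one kernel-verified Lean document; each statement's English description precedes it below -/
import Mathlib

section
/- Let G be a finite connected chordal simple graph on at least two vertices. If G has a minimal vertex separator of cardinality 3, then the second largest distance eigenvalue of G satisfies λ2(G) > −1/2. -/
open Polynomial SimpleGraph Sum

noncomputable section

/-- The distance matrix of a graph, with real entries. -/
def distMatrix {V : Type*} [Fintype V] (G : SimpleGraph V) : Matrix V V ℝ :=
  Matrix.of fun u v => (G.dist u v : ℝ)

/-- The second largest distance eigenvalue: the eigenvalues of the distance matrix
(the roots of its characteristic polynomial, with multiplicity) are sorted in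
increasing order, and we take the one at position `card V - 2`. -/
def lambda2 {V : Type*} [Fintype V] [DecidableEq V] (G : SimpleGraph V) : ℝ :=
  ((distMatrix G).charpoly.roots.sort (· ≤ ·)).getD (Fintype.card V - 2) 0

/-- The diameter of a finite graph. -/
def graphDiam {V : Type*} [Fintype V] (G : SimpleGraph V) : ℕ :=
  Finset.univ.sup fun p : V × V => G.dist p.1 p.2

/-- A graph is chordal if every cycle of length at least 4 has a chord. -/
def IsChordal {V : Type*} (G : SimpleGraph V) : Prop :=
  ∀ (v : V) (c : G.Walk v v), c.IsCycle → 4 ≤ c.length →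
    ∃ u w : V, u ∈ c.support ∧ w ∈ c.support ∧ G.Adj u w ∧ s(u, w) ∉ c.edges

/-- Ptolemaic graph: the Ptolemy inequality for the graph distance. -/
def IsPtolemaic {V : Type*} (G : SimpleGraph V) : Prop :=
  ∀ u v w x : V,
    G.dist u v * G.dist w x ≤ G.dist u w * G.dist v x + G.dist u x * G.dist v w

/-- `S` is a `uv`-separator: `u, v ∉ S` and every walk from `u` to `v` meets `S`. -/
def IsUVSeparator {V : Type*} (G : SimpleGraph V) (S : Finset V) (u v : V) : Prop :=
  u ∉ S ∧ v ∉ S ∧ ∀ w : G.Walk u v, ∃ x ∈ w.support, x ∈ S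

/-- `S` is a minimal vertex separator: a minimal `uv`-separator for some pair of
distinct non-adjacent vertices `u, v`. -/
def IsMinimalVertexSeparator {V : Type*} (G : SimpleGraph V) (S : Finset V) : Prop :=
  ∃ u v : V, u ≠ v ∧ ¬ G.Adj u v ∧ IsUVSeparator G S u v ∧
    ∀ T : Finset V, T ⊂ S → ¬ IsUVSeparator G T u v

/-- A connected component `K` of `G − S` is full if every vertex of `S` has a
neighbour in `K`. -/
def IsFullComponent {V : Type*} (G : SimpleGraph V) (S : Finset V)
    (K : (G.induce ((S : Set V)ᶜ)).ConnectedComponent) : Prop :=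
  ∀ a ∈ S, ∃ x : ((S : Set V)ᶜ : Set V),
    (G.induce ((S : Set V)ᶜ)).connectedComponentMk x = K ∧ G.Adj a ↑x

/-- The join `G ⊕ H` of two vertex-disjoint graphs. -/
def graphJoin {α β : Type*} (G : SimpleGraph α) (H : SimpleGraph β) :
    SimpleGraph (α ⊕ β) :=
  SimpleGraph.fromRel fun x y =>
    (∃ a b, x = Sum.inl a ∧ y = Sum.inl b ∧ G.Adj a b) ∨
    (∃ a b, x = Sum.inr a ∧ y = Sum.inr b ∧ H.Adj a b) ∨
    (x.isLeft ∧ y.isRight)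

/-- The disjoint union of two vertex-disjoint graphs. -/
def graphSum {α β : Type*} (G : SimpleGraph α) (H : SimpleGraph β) :
    SimpleGraph (α ⊕ β) :=
  SimpleGraph.fromRel fun x y =>
    (∃ a b, x = Sum.inl a ∧ y = Sum.inl b ∧ G.Adj a b) ∨
    (∃ a b, x = Sum.inr a ∧ y = Sum.inr b ∧ H.Adj a b)

/-- `p` disjoint copies of the complete graph `K_r`. -/
def cliqueCopies (p r : ℕ) : SimpleGraph (Fin p × Fin r) :=
  SimpleGraph.fromRel fun x y => x.1 = y.1

/-- `q` disjoint copies of `K_1 ⊕ (K_1 ∪ K_2)` (the paw graph): in each copy,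
vertex 0 is universal, vertex 1 is otherwise isolated, vertices 2,3 form a `K_2`. -/
def pawCopies (q : ℕ) : SimpleGraph (Fin q × Fin 4) :=
  SimpleGraph.fromRel fun x y => x.1 = y.1 ∧ (x.2 = 0 ∨ (x.2 = 2 ∧ y.2 = 3))

/-- `s` disjoint copies of the path `P_3`. -/
def path3Copies (s : ℕ) : SimpleGraph (Fin s × Fin 3) :=
  SimpleGraph.fromRel fun x y => x.1 = y.1 ∧ ((x.2 = 0 ∧ y.2 = 1) ∨ (x.2 = 1 ∧ y.2 = 2))

/-- The disjoint union `p_1 K_{r_1} ∪ ⋯ ∪ p_k K_{r_k}`. -/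
def multiCliques (k : ℕ) (p r : Fin k → ℕ) :
    SimpleGraph ((i : Fin k) × (Fin (p i) × Fin (r i))) :=
  SimpleGraph.fromRel fun x y =>
    (⟨x.1, x.2.1⟩ : (i : Fin k) × Fin (p i)) = ⟨y.1, y.2.1⟩

/-- The relaxed block star
`K_1 ⊕ ((p_1 K_{r_1} ∪ ⋯ ∪ p_k K_{r_k}) ∪ q (K_1 ⊕ (K_1 ∪ K_2)) ∪ s P_3)`. -/
def relaxedBlockStar (k : ℕ) (p r : Fin k → ℕ) (q s : ℕ) :
    SimpleGraph (Unit ⊕ (((i : Fin k) × (Fin (p i) × Fin (r i))) ⊕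
      ((Fin q × Fin 4) ⊕ (Fin s × Fin 3)))) :=
  graphJoin (⊤ : SimpleGraph Unit)
    (graphSum (multiCliques k p r) (graphSum (pawCopies q) (path3Copies s)))

/-- The graph `G(r,p,q) = K_1 ⊕ (p K_r ∪ q (K_1 ⊕ (K_1 ∪ K_2)))`. -/
def Grpq (r p q : ℕ) : SimpleGraph (Unit ⊕ ((Fin p × Fin r) ⊕ (Fin q × Fin 4))) :=
  graphJoin (⊤ : SimpleGraph Unit) (graphSum (cliqueCopies p r) (pawCopies q))

/-- The full house graph `K_2 ⊕ (K_1 ∪ K_2)`: vertices 0,1 form the join-`K_2`,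
vertex 2 is the `K_1`, vertices 3,4 form the `K_2`. -/
def fullHouse : SimpleGraph (Fin 5) :=
  SimpleGraph.fromRel fun x y => x = 0 ∨ x = 1 ∨ (x = 3 ∧ y = 4)

/-- The diamond graph: `K_4` minus an edge. -/
def diamondGraph : SimpleGraph (Fin 4) :=
  SimpleGraph.fromRel fun x y => x = 0 ∨ x = 1

/-- The path on four vertices. -/
def path4 : SimpleGraph (Fin 4) :=
  SimpleGraph.fromRel fun x y => (x : ℕ) + 1 = (y : ℕ)

/-- The cycle on four vertices. -/
def cycle4 : SimpleGraph (Fin 4) :=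
  SimpleGraph.fromRel fun x y => x + 1 = y

/-- The triple block graph `Pt_2(p,q)`: a full house (on `Fin 5`, with the
join-`K_2` being vertices `a = 0`, `b = 1`) together with `p - 1` further vertices
forming with `a` a clique `K_p` and `q - 1` further vertices forming with `b`
a clique `K_q`. -/
def Pt2Graph (p q : ℕ) : SimpleGraph (Fin 5 ⊕ (Fin (p - 1) ⊕ Fin (q - 1))) :=
  SimpleGraph.fromRel fun x y =>
    match x, y with
    | Sum.inl a, Sum.inl b => a = 0 ∨ a = 1 ∨ (a = 3 ∧ b = 4)
    | Sum.inl a, Sum.inr (Sum.inl _) => a = 0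
    | Sum.inl a, Sum.inr (Sum.inr _) => a = 1
    | Sum.inr (Sum.inl _), Sum.inr (Sum.inl _) => True
    | Sum.inr (Sum.inr _), Sum.inr (Sum.inr _) => True
    | _, _ => False

/-- The nine-vertex graph `Pt_1`: a full house (vertices 0,…,4, join-`K_2` being
`a = 0`, `b = 1`, `K_2` being 3,4), a vertex 5 adjacent only to `a`, a vertex 6
adjacent only to `b`, and vertices 7,8 adjacent to each other and to `b`. -/
def Pt1Graph : SimpleGraph (Fin 9) :=
  SimpleGraph.fromRel fun x y =>
    (x = 0 ∧ (y = 1 ∨ y = 2 ∨ y = 3 ∨ y = 4 ∨ y = 5)) ∨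
    (x = 1 ∧ (y = 2 ∨ y = 3 ∨ y = 4 ∨ y = 6 ∨ y = 7 ∨ y = 8)) ∨
    (x = 3 ∧ y = 4) ∨ (x = 7 ∧ y = 8)

/-- `G` contains an induced subgraph isomorphic to `H`. -/
def HasInducedSubgraph {V W : Type*} (G : SimpleGraph V) (H : SimpleGraph W) : Prop :=
  ∃ s : Set V, Nonempty ((G.induce s) ≃g H)

/-- `G` is isomorphic to a connected induced subgraph of `H`. -/
def IsoToConnectedInducedSubgraph {V W : Type*} (G : SimpleGraph V)
    (H : SimpleGraph W) : Prop :=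
  ∃ s : Set W, (H.induce s).Connected ∧ Nonempty (G ≃g (H.induce s))

/-- A vertex is simplicial if its neighbourhood is a clique. -/
def IsSimplicial {V : Type*} (G : SimpleGraph V) (v : V) : Prop :=
  G.IsClique (G.neighborSet v)

/-- The quintic polynomial `f(r,p,q,x)`. -/
def fpoly (r p q : ℕ) : Polynomial ℝ :=
  X ^ 5 - C (8 * (q : ℝ) + 2 * (r : ℝ) * (p : ℝ) - (r : ℝ) - 8) * X ^ 4
    - C ((8 * (r : ℝ) + 36) * (q : ℝ) + 15 * (r : ℝ) * (p : ℝ) - 7 * (r : ℝ) - 20) * X ^ 3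
    - C ((28 * (r : ℝ) + 52) * (q : ℝ) + 33 * (r : ℝ) * (p : ℝ) - 13 * (r : ℝ) - 18) * X ^ 2
    - C ((24 * (r : ℝ) + 30) * (q : ℝ) + 23 * (r : ℝ) * (p : ℝ) - 5 * (r : ℝ) - 5) * X
    - C ((6 * (r : ℝ) + 6) * (q : ℝ) + 5 * (r : ℝ) * (p : ℝ))

end

section Chordal

variable {V : Type*} {G : SimpleGraph V}

/-- A path all of whose chords are among its own edges. -/
def IsInducedPath {s t : V} (p : G.Walk s t) : Prop :=
  p.IsPath ∧ ∀ x ∈ p.support, ∀ y ∈ p.support, G.Adj x y → s(x, y) ∈ p.edges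

theorem IsInducedPath.of_append {s t r : V} {p : G.Walk s t} {q : G.Walk t r}
    (h : IsInducedPath (p.append q)) : IsInducedPath p ∧ IsInducedPath q := by
  have hmem : ∀ x, x ∈ p.support → x ∈ q.support → x = t := fun x hx hx' => by
    by_contra hne
    exact h.1.ne_of_mem_support_of_append hne hx hx' rfl
  refine ⟨⟨h.1.of_append_left, fun x hx y hy hxy => ?_⟩,
    ⟨h.1.of_append_right, fun x hx y hy hxy => ?_⟩⟩
  · have := h.2 x (by simp [hx]) y (by simp [hy]) hxy
    rw [Walk.edges_append, List.mem_append] at this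
    refine this.resolve_right fun hq => hxy.ne ?_
    rw [hmem x hx (q.fst_mem_support_of_mem_edges hq),
      hmem y hy (q.snd_mem_support_of_mem_edges hq)]
  · have := h.2 x (by simp [hx]) y (by simp [hy]) hxy
    rw [Walk.edges_append, List.mem_append] at this
    refine this.resolve_left fun hp => hxy.ne ?_
    rw [hmem x (p.fst_mem_support_of_mem_edges hp) hx,
      hmem y (p.snd_mem_support_of_mem_edges hp) hy]

/-- Two vertices joined by a walk within a set are joined by an induced path within it. -/
theorem exists_isInducedPath (T : Set V) {s t : V}
    (h : ∃ p : G.Walk s t, ∀ x ∈ p.support, x ∈ T) :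
    ∃ p : G.Walk s t, IsInducedPath p ∧ ∀ x ∈ p.support, x ∈ T := by
  classical
  have hn : ∃ n, ∃ p : G.Walk s t, (∀ x ∈ p.support, x ∈ T) ∧ p.length = n :=
    let ⟨p, hp⟩ := h; ⟨_, p, hp, rfl⟩
  obtain ⟨p, hpT, hlen⟩ := Nat.find_spec hn
  have hmin : ∀ q : G.Walk s t, (∀ x ∈ q.support, x ∈ T) → p.length ≤ q.length := fun q hq => by
    rw [hlen]
    exact Nat.find_min' hn ⟨q, hq, rfl⟩
  have hpath : p.IsPath := by
    have h1 : p.bypass.length = p.length := le_antisymm p.length_bypass_le_length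
      (hmin _ fun x hx => hpT x (p.support_bypass_subset_support hx))
    rw [← p.bypass_eq_self_of_length_le_length_bypass h1.ge]
    exact p.bypass_isPath
  have key : ∀ i j, i ≤ p.length → j ≤ p.length → i < j →
      G.Adj (p.getVert i) (p.getVert j) → s(p.getVert i, p.getVert j) ∈ p.edges := by
    intro i j hi hj hij hadj
    have := hmin ((p.take i).append (Walk.cons hadj (p.drop j))) (by
      intro x hx
      rw [Walk.mem_support_append_iff, Walk.support_cons, List.mem_cons] at hx
      rcases hx with hx | rfl | hx
      · exact hpT x ((p.isSubwalk_take i).support_subset hx)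
      · exact hpT _ (p.getVert_mem_support i)
      · exact hpT x ((p.isSubwalk_drop j).support_subset hx))
    rw [Walk.length_append, Walk.length_cons, Walk.take_length, Walk.drop_length] at this
    obtain rfl : j = i + 1 := by omega
    exact p.mk_mem_edges_iff_exists.2 ⟨i, by omega, rfl⟩
  refine ⟨p, ⟨hpath, fun x hx y hy hxy => ?_⟩, hpT⟩
  obtain ⟨i, rfl, hi⟩ := Walk.mem_support_iff_exists_getVert.1 hx
  obtain ⟨j, rfl, hj⟩ := Walk.mem_support_iff_exists_getVert.1 hy
  rcases lt_trichotomy i j with hij | rfl | hij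
  · exact key i j hi hj hij hxy
  · exact absurd rfl hxy.ne
  · rw [Sym2.eq_swap]
    exact key j i hj hi hij hxy.symm

theorem two_le_length_of_not_adj {s t : V} (hne : s ≠ t) (hadj : ¬ G.Adj s t) (p : G.Walk s t) :
    2 ≤ p.length := by
  by_contra! h
  interval_cases hl : p.length
  · exact hne (Walk.eq_of_length_eq_zero hl)
  · exact hadj (Walk.adj_of_length_eq_one hl)

/-- In a chordal graph, two internally disjoint induced paths with common endpoints,
both of length at least two, are joined by an edge between interior vertices. -/
theorem IsChordal.exists_adj_interior (hG : IsChordal G) {s t : V} {p : G.Walk s t}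
    {q : G.Walk t s} (hp : IsInducedPath p) (hq : IsInducedPath q)
    (hpl : 2 ≤ p.length) (hql : 2 ≤ q.length)
    (hpq : ∀ x ∈ p.support, x ∈ q.support → x = s ∨ x = t) :
    ∃ x ∈ p.support, ∃ y ∈ q.support,
      G.Adj x y ∧ x ≠ s ∧ x ≠ t ∧ y ≠ s ∧ y ≠ t := by
  have hcyc : (p.append q).IsCycle := by
    refine hp.1.isCycle_append hq.1 (fun x hx hx' => ?_) (Or.inl hpl)
    have h1 := hp.1.support_nodup
    have h2 := hq.1.support_nodup
    rw [← Walk.cons_tail_support, List.nodup_cons] at h1 h2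
    rcases hpq x (List.mem_of_mem_tail hx) (List.mem_of_mem_tail hx') with rfl | rfl
    · exact h1.1 hx
    · exact h2.1 hx'
  obtain ⟨x, y, hx, hy, hxy, hnot⟩ := hG s _ hcyc (by rw [Walk.length_append]; omega)
  rw [Walk.edges_append, List.mem_append, not_or] at hnot
  have h1 : ¬ (x ∈ p.support ∧ y ∈ p.support) := fun h => hnot.1 (hp.2 x h.1 y h.2 hxy)
  have h2 : ¬ (x ∈ q.support ∧ y ∈ q.support) := fun h => hnot.2 (hq.2 x h.1 y h.2 hxy)
  have aux : ∀ z w : V, ¬ (z ∈ p.support ∧ w ∈ p.support) → ¬ (z ∈ q.support ∧ w ∈ q.support) →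
      z ∈ p.support → w ∈ q.support → z ≠ s ∧ z ≠ t ∧ w ≠ s ∧ w ≠ t := by
    intro z w hzw hzw' hz hw
    refine ⟨?_, ?_, ?_, ?_⟩ <;> rintro rfl
    · exact hzw' ⟨q.end_mem_support, hw⟩
    · exact hzw' ⟨q.start_mem_support, hw⟩
    · exact hzw ⟨hz, p.start_mem_support⟩
    · exact hzw ⟨hz, p.end_mem_support⟩
  rw [Walk.mem_support_append_iff] at hx hy
  rcases hx with hx | hx <;> rcases hy with hy | hy
  · exact absurd ⟨hx, hy⟩ h1
  · exact ⟨x, hx, y, hy, hxy, aux x y h1 h2 hx hy⟩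
  · exact ⟨y, hy, x, hx, hxy.symm, aux y x (fun h => h1 h.symm) (fun h => h2 h.symm) hy hx⟩
  · exact absurd ⟨hx, hy⟩ h2

/-- In a chordal graph, a vertex off an induced path that is adjacent to both of its endpoints
is adjacent to all of its vertices. -/
theorem IsChordal.adj_of_adj_endpoints (hG : IsChordal G) {z : V} (n : ℕ) :
    ∀ {s t : V} (p : G.Walk s t), p.length = n → IsInducedPath p → z ∉ p.support →
      G.Adj z s → G.Adj z t → ∀ x ∈ p.support, G.Adj z x := by
  classical
  induction n using Nat.strong_induction_on with
  | _ n ih =>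
    intro s t p hn hp hz hs ht
    have hsplit : ∀ w ∈ p.support, w ≠ s → w ≠ t → G.Adj z w →
        ∀ x ∈ p.support, G.Adj z x := by
      intro w hw hws hwt hzw x hx
      have hspec := p.take_spec hw
      have hind := (hspec.symm ▸ hp : IsInducedPath _).of_append
      rw [← hspec, Walk.mem_support_append_iff] at hx hz
      rw [not_or] at hz
      rcases hx with hx | hx
      · exact ih _ (hn ▸ p.length_takeUntil_lt_length hw hwt) _ rfl hind.1 hz.1 hs hzw x hx
      · exact ih _ (hn ▸ p.length_dropUntil_lt_length hw hws) _ rfl hind.2 hz.2 hzw ht x hx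
    by_cases hl : 2 ≤ p.length
    · have hst : s ≠ t := by
        rintro rfl
        rw [Walk.length_eq_zero_iff.2 (Walk.isPath_iff_nil.1 hp.1)] at hl
        omega
      have hnst : ¬ G.Adj s t := fun hadj => by
        have := hp.1.length_eq_one_of_mem_edges
          (hp.2 s p.start_mem_support t p.end_mem_support hadj)
        omega
      have hq : IsInducedPath (Walk.cons ht.symm (Walk.cons hs Walk.nil)) := by
        refine ⟨by simp [Walk.cons_isPath_iff, hst.symm, hs.ne, ht.ne'], fun x hx y hy hxy => ?_⟩
        simp only [Walk.support_cons, Walk.support_nil, List.mem_cons, List.not_mem_nil,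
          or_false] at hx hy
        rcases hx with rfl | rfl | rfl <;> rcases hy with rfl | rfl | rfl <;>
          simp_all [G.adj_comm]
      obtain ⟨w, hw, y, hy, hwy, hws, hwt, hys, hyt⟩ :=
        hG.exists_adj_interior hp hq hl (by simp) (fun x hx hx' => by
          simp only [Walk.support_cons, Walk.support_nil, List.mem_cons, List.not_mem_nil,
            or_false] at hx'
          rcases hx' with rfl | rfl | rfl
          · exact Or.inr rfl
          · exact absurd hx hz
          · exact Or.inl rfl)
      obtain rfl : y = z := by simpa [hys, hyt] using hy
      exact hsplit w hw hws hwt hwy.symm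
    · intro x hx
      obtain ⟨i, rfl, hi⟩ := Walk.mem_support_iff_exists_getVert.1 hx
      obtain rfl | rfl : i = 0 ∨ i = p.length := by omega
      · simpa using hs
      · simpa using ht

end Chordal

section Separators

variable {V : Type*} {G : SimpleGraph V}

/-- The vertices that can be reached from `u` by a walk avoiding `S`. -/
def reachAvoiding (G : SimpleGraph V) (S : Finset V) (u : V) : Set V :=
  {x | ∃ p : G.Walk u x, ∀ y ∈ p.support, y ∉ S}

/-- Any two vertices of `A` are joined by a walk within `A`. -/
def IsWalkConnected (G : SimpleGraph V) (A : Set V) : Prop :=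
  ∀ x ∈ A, ∀ y ∈ A, ∃ p : G.Walk x y, ∀ z ∈ p.support, z ∈ A

theorem notMem_of_mem_reachAvoiding {S : Finset V} {u x : V} (hx : x ∈ reachAvoiding G S u) :
    x ∉ S :=
  let ⟨p, hp⟩ := hx
  hp x p.end_mem_support

theorem isWalkConnected_reachAvoiding (S : Finset V) (u : V) :
    IsWalkConnected G (reachAvoiding G S u) := by
  classical
  rintro x ⟨p, hp⟩ y ⟨q, hq⟩
  have hmem : ∀ {w : V} (r : G.Walk u w), (∀ y ∈ r.support, y ∉ S) →
      ∀ z ∈ r.support, z ∈ reachAvoiding G S u := fun r hr z hz =>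
    ⟨r.takeUntil z hz, fun y hy => hr y (r.support_takeUntil_subset_support hz hy)⟩
  refine ⟨p.reverse.append q, fun z hz => ?_⟩
  rw [Walk.mem_support_append_iff, Walk.support_reverse, List.mem_reverse] at hz
  exact hz.elim (hmem p hp z) (hmem q hq z)

theorem IsUVSeparator.not_adj {S : Finset V} {u v x y : V} (h : IsUVSeparator G S u v)
    (hx : x ∈ reachAvoiding G S u) (hy : y ∈ reachAvoiding G S v) : ¬ G.Adj x y := by
  intro hxy
  obtain ⟨p, hp⟩ := hx
  obtain ⟨q, hq⟩ := hy
  obtain ⟨z, hz, hzS⟩ := h.2.2 (p.append (Walk.cons hxy q.reverse))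
  rw [Walk.mem_support_append_iff, Walk.support_cons, List.mem_cons, Walk.support_reverse,
    List.mem_reverse] at hz
  rcases hz with hz | rfl | hz
  · exact hp z hz hzS
  · exact hp z p.end_mem_support hzS
  · exact hq z hz hzS

theorem IsUVSeparator.disjoint {S : Finset V} {u v x : V} (h : IsUVSeparator G S u v)
    (hx : x ∈ reachAvoiding G S u) : x ∉ reachAvoiding G S v := by
  rintro ⟨q, hq⟩
  obtain ⟨p, hp⟩ := hx
  obtain ⟨z, hz, hzS⟩ := h.2.2 (p.append q.reverse)
  rw [Walk.mem_support_append_iff, Walk.support_reverse, List.mem_reverse] at hz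
  exact hz.elim (hp z · hzS) (hq z · hzS)

theorem IsUVSeparator.symm {S : Finset V} {u v : V} (h : IsUVSeparator G S u v) :
    IsUVSeparator G S v u :=
  ⟨h.2.1, h.1, fun w => by simpa using h.2.2 w.reverse⟩

/-- Every vertex of a minimal separator has a neighbour on the side of `u`. -/
theorem IsUVSeparator.exists_adj_reachAvoiding {S : Finset V} {u v : V}
    (h : IsUVSeparator G S u v) (hmin : ∀ T : Finset V, T ⊂ S → ¬ IsUVSeparator G T u v)
    {s : V} (hs : s ∈ S) : ∃ x ∈ reachAvoiding G S u, G.Adj s x := by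
  classical
  have hT := hmin _ (Finset.erase_ssubset hs)
  have hw : ∃ w : G.Walk u v, ∀ x ∈ w.support, x ∉ S.erase s := by
    by_contra! hcon
    exact hT ⟨fun hu => h.1 (Finset.mem_of_mem_erase hu),
      fun hv => h.2.1 (Finset.mem_of_mem_erase hv), hcon⟩
  obtain ⟨w, hw⟩ := hw
  obtain ⟨z, hz, hzS⟩ := h.2.2 w
  obtain rfl : z = s := by
    by_contra hne
    exact hw z hz (Finset.mem_erase.2 ⟨hne, hzS⟩)
  obtain ⟨r, hr⟩ : ∃ r : G.Walk z u, r = (w.takeUntil z hz).bypass.reverse := ⟨_, rfl⟩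
  have hpath : r.IsPath := hr ▸ (Walk.bypass_isPath _).reverse
  have hsub : ∀ x ∈ r.support, x ∈ w.support := by
    intro x hx
    rw [hr, Walk.support_reverse, List.mem_reverse] at hx
    exact w.support_takeUntil_subset_support hz (Walk.support_bypass_subset_support _ hx)
  cases r with
  | nil => exact absurd hs h.1
  | cons hadj r =>
    rw [Walk.cons_isPath_iff] at hpath
    refine ⟨_, ⟨r.reverse, fun y hy hyS => ?_⟩, hadj⟩
    rw [Walk.support_reverse, List.mem_reverse] at hy
    refine hw y (hsub y (by simp [hy])) (Finset.mem_erase.2 ⟨?_, hyS⟩)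
    rintro rfl
    exact hpath.2 hy

theorem IsWalkConnected.exists_isInducedPath {A : Set V} (hA : IsWalkConnected G A) {s t : V}
    (hs : ∃ x ∈ A, G.Adj s x) (ht : ∃ x ∈ A, G.Adj t x) :
    ∃ p : G.Walk s t, IsInducedPath p ∧ ∀ x ∈ p.support, x = s ∨ x = t ∨ x ∈ A := by
  obtain ⟨x, hx, hsx⟩ := hs
  obtain ⟨y, hy, hty⟩ := ht
  obtain ⟨p, hp⟩ := hA x hx y hy
  refine _root_.exists_isInducedPath {z | z = s ∨ z = t ∨ z ∈ A}
    ⟨Walk.cons hsx (p.concat hty.symm), fun z hz => ?_⟩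
  rw [Walk.support_cons, List.mem_cons, Walk.support_concat, List.mem_append,
    List.mem_singleton] at hz
  rcases hz with hz | hz | hz
  · exact Or.inl hz
  · exact Or.inr (Or.inr (hp z hz))
  · exact Or.inr (Or.inl hz)

/-- Minimal separators of chordal graphs are cliques. -/
theorem IsChordal.isClique_of_minimal (hG : IsChordal G) {S : Finset V} {u v : V}
    (h : IsUVSeparator G S u v) (hmin : ∀ T : Finset V, T ⊂ S → ¬ IsUVSeparator G T u v) :
    G.IsClique S := by
  intro s hs t ht hst
  by_contra hadj
  have hfull := fun {z : V} (hz : z ∈ S) => h.exists_adj_reachAvoiding hmin hz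
  have hfull' := fun {z : V} (hz : z ∈ S) => h.symm.exists_adj_reachAvoiding
    (fun T hT hsep => hmin T hT hsep.symm) hz
  obtain ⟨p, hp, hpA⟩ := (isWalkConnected_reachAvoiding S u).exists_isInducedPath
    (hfull hs) (hfull ht)
  obtain ⟨q, hq, hqB⟩ := (isWalkConnected_reachAvoiding S v).exists_isInducedPath
    (hfull' ht) (hfull' hs)
  obtain ⟨x, hx, y, hy, hxy, hxs, hxt, hys, hyt⟩ := hG.exists_adj_interior hp hq
    (two_le_length_of_not_adj hst hadj p)
    (two_le_length_of_not_adj hst.symm (fun h => hadj h.symm) q) (fun x hx hx' => by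
      by_contra! hne
      have hxA := ((hpA x hx).resolve_left hne.1).resolve_left hne.2
      have hxB := ((hqB x hx').resolve_left hne.2).resolve_left hne.1
      exact h.disjoint hxA hxB)
  exact h.not_adj (((hpA x hx).resolve_left hxs).resolve_left hxt)
    (((hqB y hy).resolve_left hyt).resolve_left hys) hxy

/-- In a chordal graph, if every vertex of a clique has a neighbour in a connected set disjoint
from it, then some vertex of that set is adjacent to the whole clique. -/
theorem IsChordal.exists_adj_all [Finite V] (hG : IsChordal G) {S : Finset V} {A : Set V}
    (hS : G.IsClique S) (hA : IsWalkConnected G A) (hne : A.Nonempty) (hAS : ∀ x ∈ A, x ∉ S)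
    (hfull : ∀ s ∈ S, ∃ x ∈ A, G.Adj s x) : ∃ a ∈ A, ∀ s ∈ S, G.Adj a s := by
  classical
  obtain ⟨a, ha, hmax⟩ :=
    Set.exists_max_image A (fun x => (S.filter (G.Adj x)).card) A.toFinite hne
  refine ⟨a, ha, fun t ht => ?_⟩
  by_contra hat
  obtain ⟨b, hb, htb⟩ := hfull t ht
  obtain ⟨r, hr⟩ := hA a ha b hb
  obtain ⟨p, hp, hpA⟩ := exists_isInducedPath (insert t A)
    ⟨r.concat htb.symm, fun z hz => by
      rw [Walk.support_concat, List.mem_append, List.mem_singleton] at hz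
      exact hz.elim (fun hz => Or.inr (hr z hz)) Or.inl⟩
  have hnil : ¬ p.Nil := fun hn => hAS a ha (hn.eq ▸ ht)
  have hyt : G.Adj p.penultimate t := p.adj_penultimate hnil
  have hy : p.penultimate ∈ p.support := p.getVert_mem_support _
  have hyA : p.penultimate ∈ A := (hpA _ hy).resolve_left hyt.ne
  refine (hmax _ hyA).not_gt (Finset.card_lt_card ?_)
  rw [Finset.ssubset_iff_of_subset]
  · exact ⟨t, by simp [ht, hyt], by simp [hat]⟩
  · intro s hs
    rw [Finset.mem_filter] at hs ⊢
    have hst : s ≠ t := by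
      rintro rfl
      exact hat hs.2
    have hsp : s ∉ p.support := fun hmem =>
      (hpA s hmem).elim hst (fun hsA => hAS s hsA hs.1)
    exact ⟨hs.1, (hG.adj_of_adj_endpoints _ p rfl hp hsp hs.2.symm (hS hs.1 ht hst) _ hy).symm⟩

/-- A minimal vertex separator of a chordal graph is a clique with two common neighbours
at distance two. -/
theorem IsMinimalVertexSeparator.exists_common_neighbors [Finite V] (hG : IsChordal G)
    {S : Finset V} (hS : IsMinimalVertexSeparator G S) :
    G.IsClique S ∧ ∃ a b : V, a ≠ b ∧ ¬ G.Adj a b ∧ (∀ s ∈ S, G.Adj a s) ∧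
      ∀ s ∈ S, G.Adj b s := by
  obtain ⟨u, v, -, -, h, hmin⟩ := hS
  have hclique := hG.isClique_of_minimal h hmin
  have hside : ∀ {u v : V}, IsUVSeparator G S u v →
      (∀ T : Finset V, T ⊂ S → ¬ IsUVSeparator G T u v) →
      ∃ a ∈ reachAvoiding G S u, ∀ s ∈ S, G.Adj a s := fun {u v} h hmin =>
    hG.exists_adj_all hclique (isWalkConnected_reachAvoiding S u)
      ⟨u, Walk.nil, by simpa using h.1⟩ (fun _ => notMem_of_mem_reachAvoiding)
      (fun _ hs => h.exists_adj_reachAvoiding hmin hs)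
  obtain ⟨a, ha, haS⟩ := hside h hmin
  obtain ⟨b, hb, hbS⟩ := hside h.symm fun T hT hsep => hmin T hT hsep.symm
  refine ⟨hclique, a, b, ?_, h.not_adj ha hb, haS, hbS⟩
  rintro rfl
  exact h.disjoint ha hb

end Separators

section Spectrum

open Matrix

/-- A real symmetric matrix whose quadratic form exceeds `c` times the squared norm on a
two-dimensional space of vectors has second largest eigenvalue greater than `c`. -/
theorem Matrix.IsHermitian.lt_second_eigenvalue {n : Type*} [Fintype n] [DecidableEq n]
    {A : Matrix n n ℝ} (hA : A.IsHermitian) (hn : 2 ≤ Fintype.card n) (c : ℝ) (p q : n → ℝ)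
    (hpq : ∀ α β : ℝ, (α ≠ 0 ∨ β ≠ 0) →
      c * ((α • p + β • q) ⬝ᵥ (α • p + β • q)) < (α • p + β • q) ⬝ᵥ A *ᵥ (α • p + β • q)) :
    c < (A.charpoly.roots.sort (· ≤ ·)).getD (Fintype.card n - 2) 0 := by
  by_contra! hle
  set l := A.charpoly.roots.sort (· ≤ ·) with hl
  have hroots := hA.roots_charpoly_eq_eigenvalues
  have hlen : l.length = Fintype.card n := by
    rw [hl, Multiset.length_sort, hroots, Multiset.card_map]
    rfl
  have hcount : Fintype.card n - 1 ≤ l.countP (· ≤ c) := by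
    have hsorted : l.Pairwise (· ≤ ·) := Multiset.pairwise_sort _ _
    rw [List.getD_eq_getElem _ _ (by omega)] at hle
    have hall : ∀ x ∈ l.take (Fintype.card n - 1), decide (x ≤ c) = true := by
      intro x hx
      obtain ⟨i, hi, rfl⟩ := List.mem_iff_getElem.1 hx
      rw [List.length_take] at hi
      rw [List.getElem_take, decide_eq_true_eq]
      refine le_trans ?_ hle
      exact hsorted.sortedLE.getElem_le_getElem_of_le (by omega)
    calc Fintype.card n - 1 = (l.take (Fintype.card n - 1)).length := by
          rw [List.length_take]; omega
      _ = (l.take (Fintype.card n - 1)).countP (· ≤ c) := (List.countP_eq_length.2 hall).symm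
      _ ≤ l.countP (· ≤ c) := (List.take_sublist _ _).countP_le
  have hcard : (Finset.univ.filter fun i => ¬ hA.eigenvalues i ≤ c).card ≤ 1 := by
    have h1 : l.countP (· ≤ c) = (Finset.univ.filter fun i => hA.eigenvalues i ≤ c).card := by
      rw [← Multiset.coe_countP, hl, Multiset.sort_eq, hroots, Multiset.countP_map]
      rfl
    have h2 := Finset.card_filter_add_card_filter_not (s := Finset.univ)
      (fun i => hA.eigenvalues i ≤ c)
    rw [Finset.card_univ] at h2
    omega
  obtain ⟨i₀, hi₀⟩ : ∃ i₀, ∀ i, i ≠ i₀ → hA.eigenvalues i ≤ c := by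
    have : Nonempty n := Fintype.card_pos_iff.1 (by omega)
    obtain ⟨i₀, h⟩ := Finset.card_le_one_iff_subset_singleton.1 hcard
    refine ⟨i₀, fun i hi => ?_⟩
    by_contra hc
    exact hi (by simpa using h (Finset.mem_filter.2 ⟨Finset.mem_univ i, hc⟩))
  set U : Matrix n n ℝ := ↑hA.eigenvectorUnitary
  have hUU : U * Uᵀ = 1 := by
    simpa [star_eq_conjTranspose] using Unitary.coe_mul_star_self hA.eigenvectorUnitary
  have hspec : A = U * diagonal hA.eigenvalues * Uᵀ := by
    have := hA.spectral_theorem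
    rw [Unitary.conjStarAlgAut_apply] at this
    simpa [star_eq_conjTranspose] using this
  obtain ⟨α, β, hαβ, h0⟩ : ∃ α β : ℝ, (α ≠ 0 ∨ β ≠ 0) ∧
      (Uᵀ *ᵥ (α • p + β • q)) i₀ = 0 := by
    by_cases hp : (Uᵀ *ᵥ p) i₀ = 0
    · exact ⟨1, 0, Or.inl one_ne_zero, by simpa using hp⟩
    · refine ⟨(Uᵀ *ᵥ q) i₀, -(Uᵀ *ᵥ p) i₀, Or.inr (neg_ne_zero.2 hp), ?_⟩
      simp only [mulVec_add, mulVec_smul, Pi.add_apply, Pi.smul_apply, smul_eq_mul]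
      ring
  refine (hpq α β hαβ).not_ge ?_
  set x := α • p + β • q
  set y := Uᵀ *ᵥ x with hy
  have hxx : x ⬝ᵥ x = ∑ i, y i * y i := by
    change _ = y ⬝ᵥ y
    conv_rhs => rw [hy, dotProduct_mulVec, vecMul_transpose, mulVec_mulVec, hUU, one_mulVec]
  have hxA : x ⬝ᵥ A *ᵥ x = ∑ i, hA.eigenvalues i * (y i * y i) := by
    conv_lhs => rw [hspec]
    rw [← mulVec_mulVec, ← mulVec_mulVec, dotProduct_mulVec, ← mulVec_transpose, ← hy]
    simp only [dotProduct, mulVec_diagonal]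
    exact Finset.sum_congr rfl fun i _ => by ring
  rw [hxx, hxA, Finset.mul_sum]
  refine Finset.sum_le_sum fun i _ => ?_
  by_cases hi : i = i₀
  · subst hi
    simp [h0]
  · exact mul_le_mul_of_nonneg_right (hi₀ i hi) (mul_self_nonneg _)

theorem indicator_dotProduct_indicator {n : Type*} [Fintype n] [DecidableEq n] (S T : Finset n) :
    (fun i => if i ∈ S then (1 : ℝ) else 0) ⬝ᵥ (fun i => if i ∈ T then (1 : ℝ) else 0)
      = ((S ∩ T).card : ℝ) := by
  simp [dotProduct, Finset.inter_comm]

theorem indicator_dotProduct_mulVec_indicator {n : Type*} [Fintype n] [DecidableEq n]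
    (A : Matrix n n ℝ) (S T : Finset n) :
    (fun i => if i ∈ S then (1 : ℝ) else 0) ⬝ᵥ A *ᵥ (fun i => if i ∈ T then (1 : ℝ) else 0)
      = ∑ i ∈ S, ∑ j ∈ T, A i j := by
  simp [dotProduct, mulVec, Finset.sum_ite_mem]

theorem distMatrix_isHermitian {V : Type*} [Fintype V] (G : SimpleGraph V) :
    (distMatrix G).IsHermitian := by
  ext u v
  simp [distMatrix, SimpleGraph.dist_comm]

end Spectrum

theorem dist_eq_two_of_common_neighbor {V : Type*} {G : SimpleGraph V} {a b s : V}
    (hab : a ≠ b) (hnadj : ¬ G.Adj a b) (has : G.Adj a s) (hsb : G.Adj s b) :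
    G.dist a b = 2 := by
  have hle : G.dist a b ≤ 2 := G.dist_le (Walk.cons has (Walk.cons hsb Walk.nil))
  have h0 : G.dist a b ≠ 0 := fun h =>
    hab ((has.reachable.trans hsb.reachable).dist_eq_zero_iff.1 h)
  have h1 : G.dist a b ≠ 1 := fun h => hnadj (SimpleGraph.dist_eq_one_iff_adj.1 h)
  omega

/-- A connected chordal graph with a minimal vertex separator of cardinality 3
has second largest distance eigenvalue greater than `-1/2`. -/
theorem stmt_0 {V : Type*} [Fintype V] [DecidableEq V] (G : SimpleGraph V)
    (hcard : 2 ≤ Fintype.card V) (hconn : G.Connected) (hchordal : IsChordal G)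
    (S : Finset V) (hmvs : IsMinimalVertexSeparator G S) (hS3 : S.card = 3) :
    -1/2 < lambda2 G := by
  obtain ⟨hclique, a, b, hab, hnadj, ha, hb⟩ := hmvs.exists_common_neighbors hchordal
  refine (distMatrix_isHermitian G).lt_second_eigenvalue hcard _
    (fun i => if i ∈ S then 1 else 0) (fun i => if i ∈ ({a, b} : Finset V) then 1 else 0)
    fun α β hαβ => ?_
  have hST : S ∩ {a, b} = ∅ := by
    ext x
    simp only [Finset.mem_inter, Finset.mem_insert, Finset.mem_singleton, Finset.notMem_empty,
      iff_false, not_and, not_or]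
    exact fun hx => ⟨(ha x hx).ne', (hb x hx).ne'⟩
  have hdist : ∀ x y : V, G.Adj x y → distMatrix G x y = 1 := fun x y h => by
    simp [distMatrix, SimpleGraph.dist_eq_one_iff_adj.2 h]
  have hself : ∀ x : V, distMatrix G x x = 0 := fun x => by simp [distMatrix]
  obtain ⟨s, hs⟩ : S.Nonempty := Finset.card_pos.1 (by omega)
  have hdab : distMatrix G a b = 2 := by
    simp [distMatrix, dist_eq_two_of_common_neighbor hab hnadj (ha s hs) (hb s hs).symm]
  have hdba : distMatrix G b a = 2 := by
    simp [distMatrix, dist_eq_two_of_common_neighbor hab.symm (fun h => hnadj h.symm)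
      (hb s hs) (ha s hs).symm]
  have hSS : ∑ x ∈ S, ∑ y ∈ S, distMatrix G x y = 6 := by
    have : ∀ x ∈ S, ∑ y ∈ S, distMatrix G x y = 2 := fun x hx => by
      rw [← Finset.add_sum_erase _ _ hx, hself, Finset.sum_congr rfl (fun y hy =>
        hdist x y (hclique hx (Finset.mem_of_mem_erase hy) (Finset.ne_of_mem_erase hy).symm))]
      simp [Finset.card_erase_of_mem hx, hS3]
    rw [Finset.sum_congr rfl this]
    norm_num [hS3]
  have hSab : ∑ x ∈ S, ∑ y ∈ {a, b}, distMatrix G x y = 6 := by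
    have : ∀ x ∈ S, ∑ y ∈ {a, b}, distMatrix G x y = 2 := fun x hx => by
      rw [Finset.sum_pair hab, hdist x a (ha x hx).symm, hdist x b (hb x hx).symm]
      norm_num
    rw [Finset.sum_congr rfl this]
    norm_num [hS3]
  have habS : ∑ x ∈ {a, b}, ∑ y ∈ S, distMatrix G x y = 6 := by
    rw [Finset.sum_pair hab, Finset.sum_congr rfl (fun y hy => hdist a y (ha y hy)),
      Finset.sum_congr rfl (fun y hy => hdist b y (hb y hy))]
    norm_num [hS3]
  have habab : ∑ x ∈ {a, b}, ∑ y ∈ {a, b}, distMatrix G x y = 4 := by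
    simp only [Finset.sum_pair hab, hself, hdab, hdba]
    norm_num
  simp only [Matrix.mulVec_add, Matrix.mulVec_smul, add_dotProduct, dotProduct_add,
    smul_dotProduct, dotProduct_smul, smul_eq_mul, indicator_dotProduct_indicator,
    indicator_dotProduct_mulVec_indicator, hSS, hSab, habS, habab, Finset.inter_self,
    Finset.inter_comm {a, b} S, hST, hS3, Finset.card_pair hab, Finset.card_empty]
  push_cast
  have hpos : 0 < 5 * (5 * β + 6 * α) ^ 2 + 7.5 * α ^ 2 := by
    rcases eq_or_ne α 0 with rfl | hα
    · have hβ : β ≠ 0 := by simpa using hαβ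
      rw [mul_zero, add_zero]
      positivity
    · positivity
  nlinarith
end

section
/- Let G be a finite connected chordal simple graph on at least two vertices. If G has a minimal vertex separator S of cardinality 2 whose multiplicity is at least 2 (that is, G − S has at least three full components), then the second largest distance eigenvalue of G satisfies λ2(G) > −1/2. -/
open Polynomial SimpleGraph Sum

/-- If the quadratic form of a real symmetric matrix exceeds `c` times the squared norm on the
nonzero combinations of two vectors, its second largest eigenvalue exceeds `c`. -/
lemma Matrix.IsHermitian.lt_eigenvalues₀_one {n : Type*} [Fintype n] [DecidableEq n]
    {A : Matrix n n ℝ} (hA : A.IsHermitian) (hn : 1 < Fintype.card n) {c : ℝ} (p q : n → ℝ)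
    (hpq : ∀ α β : ℝ, (α ≠ 0 ∨ β ≠ 0) →
      c * ((α • p + β • q) ⬝ᵥ (α • p + β • q)) <
        (α • p + β • q) ⬝ᵥ (A.mulVec (α • p + β • q))) :
    c < hA.eigenvalues₀ ⟨1, hn⟩ := by
  by_contra! hc
  let i₀ : n := Fintype.equivOfCardEq (Fintype.card_fin _) ⟨0, by lia⟩
  have hle : ∀ j, j ≠ i₀ → hA.eigenvalues j ≤ c := by
    intro j hj
    refine (hA.eigenvalues₀_antitone ?_).trans hc
    have : (Fintype.equivOfCardEq (Fintype.card_fin (Fintype.card n))).symm j ≠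
        (⟨0, by lia⟩ : Fin (Fintype.card n)) := by
      rwa [Ne, Equiv.symm_apply_eq]
    rw [Fin.le_def]
    rw [Ne, Fin.ext_iff] at this
    simp only at this ⊢
    lia
  let u : n → n → ℝ := fun i => hA.eigenvectorBasis i
  have parseval : ∀ x y : n → ℝ, ∑ i, (x ⬝ᵥ u i) * (u i ⬝ᵥ y) = x ⬝ᵥ y := by
    intro x y
    have := hA.eigenvectorBasis.sum_inner_mul_inner (WithLp.toLp 2 x) (WithLp.toLp 2 y)
    simpa [u, EuclideanSpace.inner_eq_star_dotProduct, dotProduct_comm] using this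
  obtain ⟨α, β, hne, horth⟩ : ∃ α β : ℝ, (α ≠ 0 ∨ β ≠ 0) ∧
      u i₀ ⬝ᵥ (α • p + β • q) = 0 := by
    by_cases hq : u i₀ ⬝ᵥ q = 0
    · exact ⟨0, 1, by simp, by simp [hq]⟩
    · refine ⟨u i₀ ⬝ᵥ q, -(u i₀ ⬝ᵥ p), .inl hq, ?_⟩
      simp only [dotProduct_add, dotProduct_smul, smul_eq_mul]
      ring
  refine (hpq α β hne).not_ge ?_
  set v := α • p + β • q
  rw [← parseval v v, ← parseval v (A.mulVec v), Finset.mul_sum]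
  refine Finset.sum_le_sum fun i _ => ?_
  have hAt : A.transpose = A := by
    simpa only [Matrix.conjTranspose_eq_transpose_of_trivial] using hA.eq
  have hi : u i ⬝ᵥ A.mulVec v = hA.eigenvalues i * (u i ⬝ᵥ v) := by
    rw [Matrix.dotProduct_mulVec, ← Matrix.mulVec_transpose, hAt]
    have := hA.mulVec_eigenvectorBasis i
    simp only [u]
    rw [this, smul_dotProduct, smul_eq_mul]
  rw [hi, dotProduct_comm v]
  by_cases h : i = i₀
  · rw [h, horth]; simp
  · nlinarith [hle i h, mul_self_nonneg (u i ⬝ᵥ v)]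

/-- For a graph on at least two vertices, `lambda2` is the entry of index one in the decreasing
list of eigenvalues of the distance matrix. -/
lemma lambda2_eq_eigenvalues₀ {V : Type*} [Fintype V] [DecidableEq V] (G : SimpleGraph V)
    (hA : (distMatrix G).IsHermitian) (hn : 1 < Fintype.card V) :
    lambda2 G = hA.eigenvalues₀ ⟨1, hn⟩ := by
  have hsort : (distMatrix G).charpoly.roots.sort (· ≤ ·) =
      (List.ofFn hA.eigenvalues₀).reverse := by
    rw [hA.roots_charpoly_eq_eigenvalues₀, Fin.univ_val_map, ← Multiset.coe_reverse,
      Multiset.coe_sort]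
    apply List.mergeSort_of_pairwise
    simp only [decide_eq_true_eq]
    rw [List.pairwise_reverse]
    exact hA.eigenvalues₀_antitone.sortedGE_ofFn.pairwise
  rw [lambda2, hsort, List.getD_eq_getElem _ _ (by simp; lia), List.getElem_reverse,
    List.getElem_ofFn]
  congr 1
  ext
  simp
  lia

namespace SimpleGraph

variable {V : Type*} {G : SimpleGraph V} {a b : V} {K L : Set V}

lemma Walk.isChordless_of_length_eq_dist {u v : V} (p : G.Walk u v)
    (hp : p.length = G.dist u v) : p.IsChordless := by
  rw [Walk.isChordless_iff_forall_mem_edges]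
  have key : ∀ i j : ℕ, i < j → j ≤ p.length → G.Adj (p.getVert i) (p.getVert j) →
      s(p.getVert i, p.getVert j) ∈ p.edges := by
    intro i j hij hj hadj
    have hd := dist_le ((p.take i).append (Walk.cons hadj (p.drop j)))
    simp only [Walk.length_append, Walk.length_cons, Walk.take_length, Walk.drop_length] at hd
    obtain rfl : j = i + 1 := by lia
    rw [Walk.mk_mem_edges_iff_exists]
    exact ⟨i, by lia, by simp⟩
  intro x y hx hy hadj
  obtain ⟨i, rfl, hi⟩ := Walk.mem_support_iff_exists_getVert.mp hx
  obtain ⟨j, rfl, hj⟩ := Walk.mem_support_iff_exists_getVert.mp hy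
  rcases lt_trichotomy i j with h | rfl | h
  · exact key i j h hj hadj
  · exact (G.loopless.irrefl _ hadj).elim
  · rw [Sym2.eq_swap]
    exact key j i h hi hadj.symm

/-- The subgraph of `G` formed by the edges having an endpoint in `K`. -/
def edgesMeeting (G : SimpleGraph V) (K : Set V) : SimpleGraph V where
  Adj x y := G.Adj x y ∧ (x ∈ K ∨ y ∈ K)
  symm := ⟨fun _ _ h => ⟨h.1.symm, h.2.symm⟩⟩
  loopless := ⟨fun _ h => G.loopless.irrefl _ h.1⟩

lemma edgesMeeting_le (G : SimpleGraph V) (K : Set V) : G.edgesMeeting K ≤ G :=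
  fun _ _ h => h.1

/-- `K` is joined to the rest of the graph through `a` and `b` only, which are connected to each
other by way of `K`. -/
structure IsLink (G : SimpleGraph V) (a b : V) (K : Set V) : Prop where
  left_notMem : a ∉ K
  right_notMem : b ∉ K
  adj_mem : ∀ x y, G.Adj x y → x ∈ K → y ∈ K ∨ y = a ∨ y = b
  reachable : (G.edgesMeeting K).Reachable a b

lemma IsLink.mem_of_mem_support (h : G.IsLink a b K) {u v x : V}
    (p : (G.edgesMeeting K).Walk u v) (hu : u ∈ K ∨ u = a ∨ u = b) (hx : x ∈ p.support) :
    x ∈ K ∨ x = a ∨ x = b := by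
  induction p with
  | nil => simp only [Walk.support_nil, List.mem_singleton] at hx; exact hx ▸ hu
  | @cons u v w hadj p ih =>
    rw [Walk.support_cons, List.mem_cons] at hx
    rcases hx with rfl | hx
    · exact hu
    · refine ih ?_ hx
      rcases hadj.2 with hk | hk
      · exact h.adj_mem _ _ hadj.1 hk
      · exact .inl hk

/-- A shortest path from `a` to `b` through a link `K`, as a walk in `G`. -/
lemma IsLink.exists_isPath (h : G.IsLink a b K) (hab : a ≠ b) :
    ∃ p : G.Walk a b, p.IsPath ∧ 2 ≤ p.length ∧
      (∀ x ∈ p.support, x ∈ K ∨ x = a ∨ x = b) ∧ s(a, b) ∉ p.edges ∧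
      (∀ x ∈ p.support, ∀ y ∈ p.support, G.Adj x y → (x ∈ K ∨ y ∈ K) → s(x, y) ∈ p.edges) ∧
      (p.length = 2 → ∃ x ∈ K, G.Adj a x ∧ G.Adj b x) := by
  obtain ⟨p, hp, hd⟩ := h.reachable.exists_path_of_dist
  have hnadj : ¬ (G.edgesMeeting K).Adj a b := fun hadj =>
    hadj.2.elim h.left_notMem h.right_notMem
  have hlen := h.reachable.one_lt_dist_of_ne_of_not_adj hab hnadj
  refine ⟨p.mapLe (edgesMeeting_le G K), (Walk.isPath_mapLe _).mpr hp, ?_, ?_, ?_, ?_, ?_⟩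
  · rw [Walk.length_mapLe]; lia
  · rw [Walk.support_mapLe_eq_support]
    exact fun x => h.mem_of_mem_support p (.inr (.inl rfl))
  · rw [Walk.edges_mapLe_eq_edges]
    exact fun he => hnadj (p.adj_of_mem_edges he)
  · rw [Walk.support_mapLe_eq_support, Walk.edges_mapLe_eq_edges]
    exact fun x hx y hy hadj hK =>
      (p.isChordless_of_length_eq_dist hd).mem_edges hx hy ⟨hadj, hK⟩
  · rw [Walk.length_mapLe]
    intro h2
    have h1 := p.adj_getVert_succ (i := 0) (by lia)
    have h2' := p.adj_getVert_succ (i := 1) (by lia)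
    rw [Walk.getVert_zero] at h1
    rw [show 1 + 1 = p.length by lia, Walk.getVert_length] at h2'
    exact ⟨p.getVert (0 + 1), h1.2.resolve_left h.left_notMem, h1.1, h2'.1.symm⟩

/-- In a chordal graph, two vertices joined through two disjoint links are adjacent. -/
lemma IsLink.adj_of_isChordal (hG : IsChordal G) (hab : a ≠ b) (hK : G.IsLink a b K)
    (hL : G.IsLink a b L) (hKL : Disjoint K L) : G.Adj a b := by
  by_contra hnadj
  obtain ⟨p, hp, hpl, hps, -, hpc, -⟩ := hK.exists_isPath hab
  obtain ⟨q, hq, hql, hqs, -, hqc, -⟩ := hL.exists_isPath hab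
  rw [Set.disjoint_left] at hKL
  have hcyc : (p.append q.reverse).IsCycle := by
    refine hp.isCycle_append hq.reverse ?_ (.inl (by lia))
    rw [List.disjoint_left]
    intro x hx hx'
    have hxa : x ≠ a := by
      rintro rfl
      have := hp.support_nodup
      rw [← Walk.cons_tail_support, List.nodup_cons] at this
      exact this.1 hx
    have hxb : x ≠ b := by
      rintro rfl
      have := hq.reverse.support_nodup
      rw [← Walk.cons_tail_support, List.nodup_cons] at this
      exact this.1 hx'
    have h1 := hps x (List.mem_of_mem_tail hx)
    have h2 := hqs x (by simpa using List.mem_of_mem_tail hx')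
    grind
  obtain ⟨x, y, hx, hy, hadj, he⟩ := hG a _ hcyc (by simp; lia)
  rw [Walk.mem_support_append_iff, Walk.support_reverse, List.mem_reverse] at hx hy
  rw [Walk.edges_append, Walk.edges_reverse, List.mem_append, List.mem_reverse, not_or] at he
  have hpa := p.start_mem_support
  have hpb := p.end_mem_support
  have hqa := q.start_mem_support
  have hqb := q.end_mem_support
  have mem_p : ∀ z, z ∈ p.support ∨ z ∈ q.support → z ∈ K ∨ z = a ∨ z = b → z ∈ p.support := by
    rintro z (hz | hz) (hzK | rfl | rfl) <;> try assumption
    rcases hqs z hz with h | rfl | rfl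
    exacts [(hKL hzK h).elim, hpa, hpb]
  have mem_q : ∀ z, z ∈ p.support ∨ z ∈ q.support → z ∈ L ∨ z = a ∨ z = b → z ∈ q.support := by
    rintro z (hz | hz) (hzL | rfl | rfl) <;> try assumption
    rcases hps z hz with h | rfl | rfl
    exacts [(hKL h hzL).elim, hqa, hqb]
  have hxyK : ¬ (x ∈ K ∨ y ∈ K) := by
    intro h
    obtain ⟨h₁, h₂⟩ : (x ∈ K ∨ x = a ∨ x = b) ∧ (y ∈ K ∨ y = a ∨ y = b) :=
      h.elim (fun h => ⟨.inl h, hK.adj_mem x y hadj h⟩)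
        (fun h => ⟨hK.adj_mem y x hadj.symm h, .inl h⟩)
    exact he.1 (hpc x (mem_p x hx h₁) y (mem_p y hy h₂) hadj h)
  have hxyL : ¬ (x ∈ L ∨ y ∈ L) := by
    intro h
    obtain ⟨h₁, h₂⟩ : (x ∈ L ∨ x = a ∨ x = b) ∧ (y ∈ L ∨ y = a ∨ y = b) :=
      h.elim (fun h => ⟨.inl h, hL.adj_mem x y hadj h⟩)
        (fun h => ⟨hL.adj_mem y x hadj.symm h, .inl h⟩)
    exact he.2 (hqc x (mem_q x hx h₁) y (mem_q y hy h₂) hadj h)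
  rw [not_or] at hxyK hxyL
  have hxab : x = a ∨ x = b :=
    hx.elim (fun h => (hps x h).resolve_left hxyK.1) (fun h => (hqs x h).resolve_left hxyL.1)
  have hyab : y = a ∨ y = b :=
    hy.elim (fun h => (hps y h).resolve_left hxyK.2) (fun h => (hqs y h).resolve_left hxyL.2)
  rcases hxab with rfl | rfl <;> rcases hyab with rfl | rfl
  exacts [hadj.ne rfl, hnadj hadj, hnadj hadj.symm, hadj.ne rfl]

/-- In a chordal graph, two adjacent vertices joined through a link have a common neighbour
there. -/
lemma IsLink.exists_common_neighbor (hG : IsChordal G) (hK : G.IsLink a b K)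
    (hab : G.Adj a b) : ∃ x ∈ K, G.Adj a x ∧ G.Adj b x := by
  obtain ⟨p, hp, hpl, hps, hpe, hpc, hp2⟩ := hK.exists_isPath hab.ne
  refine hp2 ?_
  by_contra hne
  have hcyc : (Walk.cons hab.symm p).IsCycle := by
    rw [Walk.cons_isCycle_iff, Sym2.eq_swap]
    exact ⟨hp, hpe⟩
  obtain ⟨x, y, hx, hy, hadj, he⟩ := hG b _ hcyc (by simp; lia)
  have hx' : x ∈ p.support := by
    have := p.end_mem_support
    simp only [Walk.support_cons, List.mem_cons] at hx
    grind
  have hy' : y ∈ p.support := by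
    have := p.end_mem_support
    simp only [Walk.support_cons, List.mem_cons] at hy
    grind
  rw [Walk.edges_cons, List.mem_cons, not_or] at he
  by_cases hxy : x ∈ K ∨ y ∈ K
  · exact he.2 (hpc x hx' y hy' hadj hxy)
  · have := hps x hx'
    have := hps y hy'
    have := hadj.ne
    grind

end SimpleGraph

/-- A full component of `G - {a, b}` is a link between `a` and `b`. -/
lemma IsFullComponent.isLink {V : Type*} {G : SimpleGraph V} {S : Finset V} {a b : V}
    (hS : ∀ x, x ∈ S ↔ x = a ∨ x = b) {K : (G.induce ((S : Set V)ᶜ)).ConnectedComponent}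
    (hK : IsFullComponent G S K) : G.IsLink a b (Subtype.val '' K.supp) where
  left_notMem := by
    rintro ⟨x, -, hx⟩
    exact x.2 (by simp [hx, hS])
  right_notMem := by
    rintro ⟨x, -, hx⟩
    exact x.2 (by simp [hx, hS])
  adj_mem := by
    rintro _ y hadj ⟨x, hx, rfl⟩
    by_cases hy : y ∈ S
    · exact .inr ((hS y).mp hy)
    · refine .inl ⟨⟨y, by simpa using hy⟩, ?_, rfl⟩
      exact (ConnectedComponent.mem_supp_congr_adj K
        (show (G.induce ((S : Set V)ᶜ)).Adj x ⟨y, by simpa using hy⟩ from hadj)).mp hx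
  reachable := by
    obtain ⟨x, hx, hax⟩ := hK a (by simp [hS])
    obtain ⟨y, hy, hby⟩ := hK b (by simp [hS])
    have hreach : ∀ {u v : ((S : Set V)ᶜ : Set V)} (_ : (G.induce ((S : Set V)ᶜ)).Walk u v),
        u ∈ K.supp → (G.edgesMeeting (Subtype.val '' K.supp)).Reachable u v := by
      intro u v p hu
      induction p with
      | nil => exact .refl _
      | cons hadj p ih =>
        refine Reachable.trans (Adj.reachable ?_)
          (ih ((ConnectedComponent.mem_supp_congr_adj K hadj).mp hu))
        exact ⟨hadj, .inl ⟨_, hu, rfl⟩⟩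
    obtain ⟨p⟩ := ConnectedComponent.exact (hx.trans hy.symm)
    have h1 : (G.edgesMeeting (Subtype.val '' K.supp)).Adj a x := ⟨hax, .inr ⟨x, hx, rfl⟩⟩
    have h2 : (G.edgesMeeting (Subtype.val '' K.supp)).Adj b y := ⟨hby, .inr ⟨y, hy, rfl⟩⟩
    exact h1.reachable.trans ((hreach p hx).trans h2.symm.reachable)

/-- Two adjacent vertices with three pairwise non-adjacent common neighbours force
`λ₂ > -1/2`. -/
lemma neg_half_lt_lambda2 {V : Type*} [Fintype V] [DecidableEq V] {G : SimpleGraph V}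
    {a b x y z : V} (hab : G.Adj a b) (hax : G.Adj a x) (hay : G.Adj a y) (haz : G.Adj a z)
    (hbx : G.Adj b x) (hby : G.Adj b y) (hbz : G.Adj b z)
    (hxy : x ≠ y) (hxz : x ≠ z) (hyz : y ≠ z)
    (hnxy : ¬ G.Adj x y) (hnxz : ¬ G.Adj x z) (hnyz : ¬ G.Adj y z) :
    -1/2 < lambda2 G := by
  have hA : (distMatrix G).IsHermitian := by
    ext u v
    simp [distMatrix, dist_comm]
  have hn : 1 < Fintype.card V := Fintype.one_lt_card_iff.mpr ⟨a, b, hab.ne⟩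
  rw [lambda2_eq_eigenvalues₀ G hA hn]
  have adj1 : ∀ {u v : V}, G.Adj u v → distMatrix G u v = 1 ∧ distMatrix G v u = 1 := by
    intro u v h
    simp [distMatrix, dist_eq_one_iff_adj.mpr h, dist_eq_one_iff_adj.mpr h.symm]
  have dist2 : ∀ {u v : V}, G.Adj a u → G.Adj a v → u ≠ v → ¬ G.Adj u v →
      distMatrix G u v = 2 ∧ distMatrix G v u = 2 := by
    intro u v hu hv hne hnadj
    have hle := dist_le (Walk.cons hu.symm (Walk.cons hv Walk.nil))
    have hlt := (hu.symm.reachable.trans hv.reachable).one_lt_dist_of_ne_of_not_adj hne hnadj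
    simp only [Walk.length_cons, Walk.length_nil] at hle
    have : G.dist u v = 2 := by lia
    exact ⟨by simp [distMatrix, this], by simp [distMatrix, dist_comm (u := v), this]⟩
  have dist0 : ∀ u, distMatrix G u u = 0 := by simp [distMatrix]
  refine hA.lt_eigenvalues₀_one hn (Pi.single a 1 + Pi.single b 1)
    (Pi.single x 1 + Pi.single y 1 + Pi.single z 1) fun α β hne => ?_
  have hnorm : (α • (Pi.single a 1 + Pi.single b 1) +
      β • (Pi.single x 1 + Pi.single y 1 + Pi.single z 1) : V → ℝ) ⬝ᵥ
      (α • (Pi.single a 1 + Pi.single b 1) +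
      β • (Pi.single x 1 + Pi.single y 1 + Pi.single z 1)) = 2 * α ^ 2 + 3 * β ^ 2 := by
    simp [dotProduct_add, hab.ne, hab.ne', hax.ne, hax.ne',
      hay.ne, hay.ne', haz.ne, haz.ne', hbx.ne, hbx.ne', hby.ne, hby.ne', hbz.ne, hbz.ne',
      hxy, hxz, hyz, hxy.symm, hxz.symm, hyz.symm]
    ring
  have hform : (α • (Pi.single a 1 + Pi.single b 1) +
      β • (Pi.single x 1 + Pi.single y 1 + Pi.single z 1) : V → ℝ) ⬝ᵥ
      ((distMatrix G).mulVec (α • (Pi.single a 1 + Pi.single b 1) +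
      β • (Pi.single x 1 + Pi.single y 1 + Pi.single z 1))) =
      2 * α ^ 2 + 12 * α * β + 12 * β ^ 2 := by
    simp [add_dotProduct, dotProduct_add, Matrix.mulVec_add, Matrix.mulVec_smul, dist0,
      adj1 hab, adj1 hax, adj1 hay, adj1 haz, adj1 hbx, adj1 hby, adj1 hbz,
      dist2 hax hay hxy hnxy, dist2 hax haz hxz hnxz, dist2 hay haz hyz hnyz]
    ring
  rw [hnorm, hform]
  rcases eq_or_ne β 0 with rfl | hβ
  · have : 0 < α ^ 2 := by simpa [sq_pos_iff] using hne
    linarith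
  · have : 0 < β ^ 2 := by positivity
    nlinarith [sq_nonneg (α + 2 * β)]

/-- A connected chordal graph with a minimal vertex separator of cardinality 2 of
multiplicity at least 2 (i.e. with at least three full components in `G − S`)
has second largest distance eigenvalue greater than `-1/2`. -/
theorem stmt_1 {V : Type*} [Fintype V] [DecidableEq V] (G : SimpleGraph V)
    (hcard : 2 ≤ Fintype.card V) (hconn : G.Connected) (hchordal : IsChordal G)
    (S : Finset V) (hmvs : IsMinimalVertexSeparator G S) (hS2 : S.card = 2)
    (hmult : ∃ K₁ K₂ K₃ : (G.induce ((S : Set V)ᶜ)).ConnectedComponent,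
      K₁ ≠ K₂ ∧ K₁ ≠ K₃ ∧ K₂ ≠ K₃ ∧
      IsFullComponent G S K₁ ∧ IsFullComponent G S K₂ ∧ IsFullComponent G S K₃) :
    -1/2 < lambda2 G := by
  obtain ⟨K₁, K₂, K₃, h12, h13, h23, hK₁, hK₂, hK₃⟩ := hmult
  obtain ⟨a, b, hab, rfl⟩ := Finset.card_eq_two.mp hS2
  have hS : ∀ x, x ∈ ({a, b} : Finset V) ↔ x = a ∨ x = b := by simp
  have hdisj : ∀ {K L : (G.induce ((({a, b} : Finset V) : Set V)ᶜ)).ConnectedComponent},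
      K ≠ L → Disjoint (Subtype.val '' K.supp) (Subtype.val '' L.supp) := fun h =>
    (Set.disjoint_image_iff Subtype.val_injective).mpr
      (SimpleGraph.pairwise_disjoint_supp_connectedComponent _ h)
  have hL₁ := hK₁.isLink hS
  have hL₂ := hK₂.isLink hS
  have hL₃ := hK₃.isLink hS
  have hadj : G.Adj a b := hL₁.adj_of_isChordal hchordal hab hL₂ (hdisj h12)
  obtain ⟨x, hx, hax, hbx⟩ := hL₁.exists_common_neighbor hchordal hadj
  obtain ⟨y, hy, hay, hby⟩ := hL₂.exists_common_neighbor hchordal hadj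
  obtain ⟨z, hz, haz, hbz⟩ := hL₃.exists_common_neighbor hchordal hadj
  have hne : ∀ {K L : Set V}, Disjoint K L → ∀ {u v : V}, u ∈ K → v ∈ L → u ≠ v :=
    fun h _ _ hu hv => h.ne_of_mem hu hv
  have hnadj : ∀ {K L : Set V}, G.IsLink a b K → Disjoint K L → ∀ {u v : V}, u ∈ K → v ∈ L →
      G.Adj a v → G.Adj b v → ¬ G.Adj u v := fun hK h u v hu hv ha hb huv =>
    (hK.adj_mem u v huv hu).elim (h.notMem_of_mem_right hv)
      (fun h => h.elim ha.ne' hb.ne')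
  exact neg_half_lt_lambda2 hadj hax hay haz hbx hby hbz
    (hne (hdisj h12) hx hy) (hne (hdisj h13) hx hz) (hne (hdisj h23) hy hz)
    (hnadj hL₁ (hdisj h12) hx hy hay hby) (hnadj hL₁ (hdisj h13) hx hz haz hbz)
    (hnadj hL₂ (hdisj h23) hy hz haz hbz)
end
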